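/- arXiv:math/0603111 — 2 statements merged into one kernel-verified Lean document; each statement's English description precedes it below -/
import Mathlib

section
/- In Pic(S_8) ≅ ℤ^9, each (-1)-class D intersects exactly 126 other (-1)-classes with intersection number 1, and exactly 56 other (-1)-classes with intersection number 2. -/
open Finset

/-- Intersection form on Pic = ℤ^9 with matrix diag(1,-1,...,-1). -/
def dot (x y : Fin 9 → ℤ) : ℤ := x 0 * y 0 - ∑ i : Fin 8, x i.succ * y i.succ

/-- The canonical class K = (-3,1,...,1). -/
def K : Fin 9 → ℤ := fun i => if i = 0 then -3 else 1

/-- A (-1)-class: D·D = -1 and D·K = -1. -/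
def isNegClass (D : Fin 9 → ℤ) : Prop := dot D D = -1 ∧ dot D K = -1

/-- The sum of the squares of the entries of a list. -/
def sumSq (l : List ℤ) : ℤ := (l.map fun a => a * a).sum

lemma sumSq_cons (a : ℤ) (l : List ℤ) : sumSq (a :: l) = a * a + sumSq l := by simp [sumSq]

lemma two_mul_mul_sum_le (a : ℤ) (l : List ℤ) :
    2 * a * l.sum ≤ sumSq l + l.length * (a * a) := by
  induction l with
  | nil => simp [sumSq]
  | cons b l ih =>
    rw [sumSq_cons, List.sum_cons, List.length_cons]
    push_cast
    nlinarith [sq_nonneg (a - b)]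

/-- The Cauchy-Schwarz inequality for a list against the constant list `1`. -/
lemma sum_mul_sum_le (l : List ℤ) : l.sum * l.sum ≤ l.length * sumSq l := by
  induction l with
  | nil => simp
  | cons a l ih =>
    rw [sumSq_cons, List.sum_cons, List.length_cons]
    push_cast
    nlinarith [two_mul_mul_sum_le a l]

/-- The lists of length `n` with entries in `[-3, 1]`, sum `s` and sum of squares `q`. -/
def boundedLists : ℕ → ℤ → ℤ → List (List ℤ)
  | 0, s, q => if s = 0 ∧ q = 0 then [[]] else []
  | n + 1, s, q =>
    if s * s ≤ (n + 1 : ℕ) * q then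
      [-3, -2, -1, 0, 1].flatMap fun a => (boundedLists n (s - a) (q - a * a)).map (a :: ·)
    else []

lemma mem_boundedLists {n : ℕ} {s q : ℤ} {l : List ℤ} :
    l ∈ boundedLists n s q ↔
      l.length = n ∧ (∀ a ∈ l, a ∈ [-3, -2, -1, 0, 1]) ∧ l.sum = s ∧ sumSq l = q := by
  induction n generalizing s q l with
  | zero =>
    rw [boundedLists, List.length_eq_zero_iff]
    constructor
    · intro h
      split_ifs at h with h0
      · obtain rfl : l = [] := by simpa using h
        simp [sumSq, h0.1, h0.2]
      · simp at h
    · rintro ⟨rfl, -, rfl, rfl⟩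
      simp [sumSq]
  | succ n ih =>
    rw [boundedLists]
    constructor
    · intro h
      split_ifs at h
      · obtain ⟨a, ha, h⟩ := List.mem_flatMap.1 h
        obtain ⟨m, hm, rfl⟩ := List.mem_map.1 h
        obtain ⟨hl, hb, hs, hq⟩ := ih.1 hm
        refine ⟨by simp [hl], ?_, by rw [List.sum_cons, hs]; ring,
          by rw [sumSq_cons, hq]; ring⟩
        intro b hb'
        rcases List.mem_cons.1 hb' with rfl | hb'
        exacts [ha, hb b hb']
      · simp at h
    · rintro ⟨hl, hb, rfl, rfl⟩
      have hc := sum_mul_sum_le l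
      rw [hl] at hc
      rw [if_pos hc]
      cases l with
      | nil => simp at hl
      | cons a l =>
        refine List.mem_flatMap.2 ⟨a, hb a List.mem_cons_self, List.mem_map.2 ⟨l, ih.2 ?_, rfl⟩⟩
        refine ⟨by simpa using hl, fun b h => hb b (List.mem_cons_of_mem _ h), ?_, ?_⟩
        · rw [List.sum_cons]; ring
        · rw [sumSq_cons]; ring

lemma nodup_flatMap_cons {as : List ℤ} (h : as.Nodup) {f : ℤ → List (List ℤ)}
    (hf : ∀ a, (f a).Nodup) : (as.flatMap fun a => (f a).map (a :: ·)).Nodup := by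
  rw [List.nodup_flatMap]
  refine ⟨fun a _ => (hf a).map (List.cons_injective), h.imp fun {a b} hab => ?_⟩
  intro l hl hl'
  obtain ⟨m, -, rfl⟩ := List.mem_map.1 hl
  obtain ⟨m', -, h'⟩ := List.mem_map.1 hl'
  exact hab (List.cons.inj h').1.symm

lemma nodup_boundedLists (n : ℕ) (s q : ℤ) : (boundedLists n s q).Nodup := by
  induction n generalizing s q with
  | zero => rw [boundedLists]; split_ifs <;> simp
  | succ n ih =>
    rw [boundedLists]
    split_ifs
    · exact nodup_flatMap_cons (by decide) fun a => ih _ _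
    · simp

/-- The coordinate lists of the `(-1)`-classes. -/
def negClassLists : List (List ℤ) :=
  [0, 1, 2, 3, 4, 5, 6].flatMap fun d => (boundedLists 8 (1 - 3 * d) (d * d + 1)).map (d :: ·)

lemma nodup_negClassLists : negClassLists.Nodup :=
  nodup_flatMap_cons (by decide) fun _ => nodup_boundedLists _ _ _

lemma degree_mem {d : ℤ} {l : List ℤ} (hl : l.length = 8) (hs : l.sum = 1 - 3 * d)
    (hq : sumSq l = d * d + 1) : d ∈ [0, 1, 2, 3, 4, 5, 6] := by
  have hc := sum_mul_sum_le l
  have key : ∀ m : List ℤ, 0 ≤ sumSq m + 5 * m.sum + 6 * m.length ∧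
      0 ≤ sumSq m - m.sum := by
    intro m
    induction m with
    | nil => simp [sumSq]
    | cons a m ih =>
      rw [sumSq_cons, List.sum_cons, List.length_cons]
      push_cast
      constructor
      · rcases le_or_gt a (-3) with h | h <;> nlinarith
      · rcases le_or_gt a 0 with h | h <;> nlinarith
  obtain ⟨k1, k2⟩ := key l
  rw [hs, hq] at k1 k2 hc
  rw [hl] at k1 hc
  push_cast at k1 hc
  have h1 : 0 ≤ d := by nlinarith
  have h6 : d ≤ 6 := by nlinarith
  interval_cases d <;> simp

lemma entry_mem {d a : ℤ} {l : List ℤ} (hl : l.length = 8) (hs : l.sum = 1 - 3 * d)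
    (hq : sumSq l = d * d + 1) (ha : a ∈ l) : a ∈ [-3, -2, -1, 0, 1] := by
  have hd := degree_mem hl hs hq
  have hp := List.perm_cons_erase ha
  have hc := sum_mul_sum_le (l.erase a)
  have h1 : (l.erase a).length = 7 := by rw [List.length_erase_of_mem ha, hl]
  have h2 : a + (l.erase a).sum = l.sum := by rw [hp.sum_eq, List.sum_cons]
  have h3 : a * a + sumSq (l.erase a) = sumSq l := by
    rw [← sumSq_cons]; exact ((hp.map _).sum_eq).symm
  rw [h1, eq_sub_of_add_eq' h2, eq_sub_of_add_eq' h3, hs, hq] at hc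
  push_cast at hc
  have hlo : -3 ≤ a := by
    by_contra! h
    simp only [List.mem_cons, List.not_mem_nil, or_false] at hd
    rcases hd with rfl | rfl | rfl | rfl | rfl | rfl | rfl <;> nlinarith
  have hhi : a ≤ 1 := by
    by_contra! h
    simp only [List.mem_cons, List.not_mem_nil, or_false] at hd
    rcases hd with rfl | rfl | rfl | rfl | rfl | rfl | rfl <;> nlinarith
  interval_cases a <;> simp

lemma cons_mem_negClassLists {d : ℤ} {l : List ℤ} :
    d :: l ∈ negClassLists ↔ l.length = 8 ∧ l.sum = 1 - 3 * d ∧ sumSq l = d * d + 1 := by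
  constructor
  · intro h
    obtain ⟨e, -, h⟩ := List.mem_flatMap.1 h
    obtain ⟨m, hm, h⟩ := List.mem_map.1 h
    obtain ⟨rfl, rfl⟩ := List.cons.inj h
    obtain ⟨hl, -, hs, hq⟩ := mem_boundedLists.1 hm
    exact ⟨hl, hs, hq⟩
  · rintro ⟨hl, hs, hq⟩
    exact List.mem_flatMap.2 ⟨d, degree_mem hl hs hq, List.mem_map.2
      ⟨l, mem_boundedLists.2 ⟨hl, fun a ha => entry_mem hl hs hq ha, hs, hq⟩, rfl⟩⟩

lemma length_of_mem_negClassLists {l : List ℤ} (h : l ∈ negClassLists) : l.length = 9 := by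
  cases l with
  | nil => simp [negClassLists] at h
  | cons d l => simp [(cons_mem_negClassLists.1 h).1]

lemma ofFn_mem_negClassLists {D : Fin 9 → ℤ} : List.ofFn D ∈ negClassLists ↔ isNegClass D := by
  rw [List.ofFn_succ, cons_mem_negClassLists, List.sum_ofFn, sumSq, List.map_ofFn, List.sum_ofFn]
  simp only [isNegClass, dot, K, Fin.succ_ne_zero, if_true, if_false, mul_one, List.length_ofFn,
    true_and, Function.comp_apply]
  constructor <;> rintro ⟨h1, h2⟩ <;> constructor <;> linarith

/-- The intersection form on coordinate lists. -/
def listDot : List ℤ → List ℤ → ℤ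
  | a :: l, b :: m => a * b - (List.zipWith (· * ·) l m).sum
  | _, _ => 0

lemma listDot_ofFn (x y : Fin 9 → ℤ) : listDot (List.ofFn x) (List.ofFn y) = dot x y := by
  simp [List.ofFn_succ, listDot, dot, Fin.sum_univ_succ]

lemma ncard_dot_eq {D : Fin 9 → ℤ} (h : isNegClass D) {k : ℤ} (hk : k ≠ -1) :
    {D' : Fin 9 → ℤ | isNegClass D' ∧ D' ≠ D ∧ dot D D' = k}.ncard =
      negClassLists.countP fun l => listDot (List.ofFn D) l = k := by
  rw [← Set.ncard_image_of_injective _ (List.ofFn_injective (n := 9)), List.countP_eq_length_filter,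
    ← List.toFinset_card_of_nodup (nodup_negClassLists.filter _), ← Set.ncard_coe_finset]
  congr 1
  ext l
  simp only [Set.mem_image, Set.mem_ofPred_eq, List.coe_toFinset, List.mem_filter,
    decide_eq_true_eq]
  constructor
  · rintro ⟨E, ⟨hE, -, hd⟩, rfl⟩
    exact ⟨ofFn_mem_negClassLists.2 hE, by rw [listDot_ofFn, hd]⟩
  · rintro ⟨hl, hd⟩
    obtain ⟨E, rfl⟩ : ∃ E : Fin 9 → ℤ, List.ofFn E = l := by
      have h9 := length_of_mem_negClassLists hl
      exact ⟨fun i => l.get (i.cast h9.symm), List.ext_get (by simp [h9]) fun n _ _ => by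
        rw [List.get_ofFn]; rfl⟩
    rw [listDot_ofFn] at hd
    refine ⟨E, ⟨ofFn_mem_negClassLists.1 hl, ?_, hd⟩, rfl⟩
    rintro rfl
    exact hk (hd.symm.trans h.1)

lemma countP_listDot_eq : ∀ l ∈ negClassLists, l.tail.Pairwise (· ≤ ·) →
    negClassLists.countP (fun m => listDot l m = 1) = 126 ∧
      negClassLists.countP (fun m => listDot l m = 2) = 56 := by
  decide +kernel

/-- Permutation of the last eight coordinates. -/
def permute (σ : Equiv.Perm (Fin 8)) (x : Fin 9 → ℤ) : Fin 9 → ℤ :=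
  Fin.cons (x 0) fun i => x (σ i).succ

lemma permute_symm_permute (σ : Equiv.Perm (Fin 8)) (x : Fin 9 → ℤ) :
    permute σ⁻¹ (permute σ x) = x := by
  funext i
  cases i using Fin.cases <;> simp [permute]

lemma permute_injective (σ : Equiv.Perm (Fin 8)) : Function.Injective (permute σ) :=
  Function.LeftInverse.injective (permute_symm_permute σ)

lemma dot_permute (σ : Equiv.Perm (Fin 8)) (x y : Fin 9 → ℤ) :
    dot (permute σ x) (permute σ y) = dot x y := by
  simp only [dot, permute, Fin.cons_zero, Fin.cons_succ]
  rw [Equiv.sum_comp σ fun i => x i.succ * y i.succ]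

lemma permute_K (σ : Equiv.Perm (Fin 8)) : permute σ K = K := by
  funext i
  cases i using Fin.cases <;> simp [permute, K]

lemma isNegClass_permute (σ : Equiv.Perm (Fin 8)) {x : Fin 9 → ℤ} :
    isNegClass (permute σ x) ↔ isNegClass x := by
  have h := dot_permute σ x K
  rw [permute_K] at h
  rw [isNegClass, isNegClass, dot_permute, h]

lemma ncard_permute (σ : Equiv.Perm (Fin 8)) (D : Fin 9 → ℤ) (k : ℤ) :
    {D' : Fin 9 → ℤ | isNegClass D' ∧ D' ≠ permute σ D ∧ dot (permute σ D) D' = k}.ncard =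
      {D' : Fin 9 → ℤ | isNegClass D' ∧ D' ≠ D ∧ dot D D' = k}.ncard := by
  rw [← Set.ncard_image_of_injective
    {D' | isNegClass D' ∧ D' ≠ D ∧ dot D D' = k} (permute_injective σ)]
  congr 1
  ext E
  simp only [Set.mem_image, Set.mem_ofPred_eq]
  constructor
  · rintro ⟨hE, hne, hd⟩
    obtain ⟨F, rfl⟩ : ∃ F, permute σ F = E :=
      ⟨permute σ⁻¹ E, by simpa using permute_symm_permute σ⁻¹ E⟩
    refine ⟨F, ⟨(isNegClass_permute σ).1 hE, ?_, by rwa [dot_permute] at hd⟩, rfl⟩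
    rintro rfl
    exact hne rfl
  · rintro ⟨F, ⟨hF, hne, hd⟩, rfl⟩
    exact ⟨(isNegClass_permute σ).2 hF, (permute_injective σ).ne hne, by rwa [dot_permute]⟩

theorem stmt13 (D : Fin 9 → ℤ) (h : isNegClass D) :
    {D' : Fin 9 → ℤ | isNegClass D' ∧ D' ≠ D ∧ dot D D' = 1}.ncard = 126 ∧
    {D' : Fin 9 → ℤ | isNegClass D' ∧ D' ≠ D ∧ dot D D' = 2}.ncard = 56 := by
  set σ := Tuple.sort fun i : Fin 8 => D i.succ
  have hσ : isNegClass (permute σ D) := (isNegClass_permute σ).2 h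
  rw [← ncard_permute σ D, ← ncard_permute σ D, ncard_dot_eq hσ (by norm_num),
    ncard_dot_eq hσ (by norm_num)]
  refine countP_listDot_eq _ (ofFn_mem_negClassLists.2 hσ) ?_
  rw [List.ofFn_succ, List.tail_cons, List.pairwise_ofFn]
  exact fun i j hij => Tuple.monotone_sort (fun i : Fin 8 => D i.succ) hij.le
end

section
/- In Pic(S_8) ≅ ℤ^9, there are exactly 2160 rulings, i.e., classes of the form D_1 + D_2 with D_1, D_2 (-1)-classes satisfying D_1·D_2 = 1, and each such ruling admits exactly 7 unordered representations as such a sum. -/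
open Finset

/-- A ruling: a sum of two (-1)-classes with intersection number 1. -/
def IsRuling (R : Fin 9 → ℤ) : Prop :=
  ∃ D1 D2, isNegClass D1 ∧ isNegClass D2 ∧ dot D1 D2 = 1 ∧ R = D1 + D2

theorem dot_comm (x y : Fin 9 → ℤ) : dot x y = dot y x := by
  simp only [dot, mul_comm]

theorem dot_add_left (x y z : Fin 9 → ℤ) : dot (x + y) z = dot x z + dot y z := by
  simp only [dot, Fin.sum_univ_succ, Pi.add_apply]
  ring

theorem dot_smul_left (c : ℤ) (x z : Fin 9 → ℤ) : dot (c • x) z = c * dot x z := by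
  simp only [dot, mul_sub, Finset.mul_sum, Pi.smul_apply, smul_eq_mul, mul_assoc]

theorem dot_sub_left (x y z : Fin 9 → ℤ) : dot (x - y) z = dot x z - dot y z := by
  simp only [dot, Fin.sum_univ_succ, Pi.sub_apply]
  ring

theorem dot_add_right (x y z : Fin 9 → ℤ) : dot x (y + z) = dot x y + dot x z := by
  rw [dot_comm, dot_add_left, dot_comm y, dot_comm z]

theorem dot_sub_right (x y z : Fin 9 → ℤ) : dot x (y - z) = dot x y - dot x z := by
  rw [dot_comm, dot_sub_left, dot_comm y, dot_comm z]

theorem dot_smul_right (c : ℤ) (x z : Fin 9 → ℤ) : dot x (c • z) = c * dot x z := by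
  rw [dot_comm, dot_smul_left, dot_comm z]

/-! ### Enumeration of the (-1)-classes -/

/-- The vectors of length `n` with entries between `-3` and `1`, sum `s` and sum of squares `q`. -/
def vectorsWithSums : (n : ℕ) → ℤ → ℤ → List (Fin n → ℤ)
  | 0, s, q => if s = 0 ∧ q = 0 then [![]] else []
  | n + 1, s, q =>
    [-3, -2, -1, 0, 1].flatMap fun b : ℤ =>
      if (s - b) * (s - b) ≤ n * (q - b * b) then
        (vectorsWithSums n (s - b) (q - b * b)).map (Matrix.vecCons b)
      else []

theorem mem_vectorsWithSums {n : ℕ} {s q : ℤ} (x : Fin n → ℤ) :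
    x ∈ vectorsWithSums n s q ↔
      (∀ i, -3 ≤ x i ∧ x i ≤ 1) ∧ ∑ i, x i = s ∧ ∑ i, x i ^ 2 = q := by
  induction n generalizing s q with
  | zero =>
    by_cases h : s = 0 ∧ q = 0
    · simp [vectorsWithSums, h, Subsingleton.elim x ![]]
    · simp only [vectorsWithSums, h, if_false, List.not_mem_nil, false_iff,
        Finset.univ_eq_empty, Finset.sum_empty]
      exact fun h' => h ⟨h'.2.1.symm, h'.2.2.symm⟩
  | succ n ih =>
    rw [vectorsWithSums, List.mem_flatMap, Fin.sum_univ_succ, Fin.sum_univ_succ,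
      Fin.forall_fin_succ]
    constructor
    · rintro ⟨b, hb, h⟩
      split_ifs at h
      · obtain ⟨y, hy, rfl⟩ := List.mem_map.1 h
        obtain ⟨h1, h2, h3⟩ := (ih y).1 hy
        simp only [List.mem_cons, List.not_mem_nil, or_false] at hb
        simp only [Matrix.cons_val_zero, Matrix.cons_val_succ, sq b]
        exact ⟨⟨by omega, h1⟩, by omega, by omega⟩
      · simp at h
    · rintro ⟨⟨h0, h⟩, h1, h2⟩
      have hs : ∑ i : Fin n, x i.succ = s - x 0 := by omega
      have hs2 : ∑ i : Fin n, x i.succ ^ 2 = q - x 0 * x 0 := by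
        rw [← sq]
        omega
      have hcs := sq_sum_le_card_mul_sum_sq (s := Finset.univ) (f := fun i : Fin n => x i.succ)
      rw [hs, hs2, Finset.card_univ, Fintype.card_fin, sq] at hcs
      refine ⟨x 0, ?_, ?_⟩
      · simp only [List.mem_cons, List.not_mem_nil, or_false]
        omega
      · rw [if_pos hcs, List.mem_map]
        exact ⟨fun i => x i.succ, (ih _).2 ⟨h, hs, hs2⟩, Matrix.cons_head_tail x⟩

theorem nodup_flatMap_vecCons {n : ℕ} {l : List ℤ} (hl : l.Nodup)
    {f : ℤ → List (Fin n → ℤ)} (hf : ∀ b ∈ l, (f b).Nodup) :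
    (l.flatMap fun b => (f b).map (Matrix.vecCons b)).Nodup := by
  rw [List.nodup_flatMap]
  refine ⟨fun b hb => (hf b hb).map fun x y h => (Matrix.vecCons_inj.1 h).2, hl.imp ?_⟩
  intro a b hab x hxa hxb
  obtain ⟨y, -, rfl⟩ := List.mem_map.1 hxa
  obtain ⟨z, -, hz⟩ := List.mem_map.1 hxb
  exact hab (Matrix.vecCons_inj.1 hz).1.symm

theorem nodup_vectorsWithSums (n : ℕ) (s q : ℤ) : (vectorsWithSums n s q).Nodup := by
  induction n generalizing s q with
  | zero =>
    rw [vectorsWithSums]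
    split_ifs <;> simp
  | succ n ih =>
    rw [vectorsWithSums]
    have := nodup_flatMap_vecCons (n := n)
      (l := [-3, -2, -1, 0, 1]) (by decide)
      (f := fun b => if (s - b) * (s - b) ≤ n * (q - b * b) then
        vectorsWithSums n (s - b) (q - b * b) else [])
      (fun b _ => by split_ifs <;> simp [ih])
    convert this using 3 with b
    split_ifs <;> simp

def negClassList : List (Fin 9 → ℤ) :=
  [-1, 0, 1, 2, 3, 4, 5, 6, 7].flatMap fun a : ℤ =>
    (vectorsWithSums 8 (1 - 3 * a) (a ^ 2 + 1)).map (Matrix.vecCons a)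

def negClasses : Finset (Fin 9 → ℤ) :=
  ⟨negClassList, nodup_flatMap_vecCons (by decide) fun _ _ => nodup_vectorsWithSums _ _ _⟩

theorem isNegClass_iff_sums (D : Fin 9 → ℤ) :
    isNegClass D ↔ ∑ i : Fin 8, D i.succ = 1 - 3 * D 0 ∧
      ∑ i : Fin 8, D i.succ ^ 2 = D 0 ^ 2 + 1 := by
  have h : dot D K = -3 * D 0 - ∑ i : Fin 8, D i.succ := by
    simp [dot, K, Fin.succ_ne_zero, mul_comm]
  rw [isNegClass, h, dot]
  simp only [sq]
  constructor <;> rintro ⟨h1, h2⟩ <;> constructor <;> linarith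

theorem mem_negClasses {D : Fin 9 → ℤ} : D ∈ negClasses ↔ isNegClass D := by
  change D ∈ negClassList ↔ _
  rw [negClassList, List.mem_flatMap, isNegClass_iff_sums]
  constructor
  · rintro ⟨a, -, h⟩
    obtain ⟨y, hy, rfl⟩ := List.mem_map.1 h
    exact ((mem_vectorsWithSums y).1 hy).2
  · rintro ⟨h1, h2⟩
    have hcs := sq_sum_le_card_mul_sum_sq (s := Finset.univ) (f := fun i : Fin 8 => D i.succ)
    rw [h1, h2, Finset.card_univ, Fintype.card_fin] at hcs
    push_cast at hcs
    have hl : -1 ≤ D 0 := by nlinarith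
    have hu : D 0 ≤ 7 := by nlinarith
    have hbound : ∀ i : Fin 8, -3 ≤ D i.succ ∧ D i.succ ≤ 1 := by
      intro i
      have hi := sq_sum_le_card_mul_sum_sq (s := Finset.univ)
        (f := fun j : Fin 7 => D (i.succAbove j).succ)
      rw [Fin.sum_univ_succAbove _ i] at h1 h2
      rw [eq_sub_of_add_eq' h1, eq_sub_of_add_eq' h2, Finset.card_univ, Fintype.card_fin] at hi
      push_cast at hi
      generalize D i.succ = x at hi
      generalize D 0 = a at hi hl hu
      clear * - hi hl hu
      interval_cases a <;> constructor <;> nlinarith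
    refine ⟨D 0, ?_, List.mem_map.2 ⟨fun i => D i.succ,
      (mem_vectorsWithSums _).2 ⟨hbound, h1, h2⟩, Matrix.cons_head_tail D⟩⟩
    simp only [List.mem_cons, List.not_mem_nil, or_false]
    omega

theorem card_negClasses : negClasses.card = 240 := by
  change negClassList.length = 240
  decide +kernel

/-! ### Reflections -/

/-- The reflection in a class of square `-2`. -/
def rootReflection (v x : Fin 9 → ℤ) : Fin 9 → ℤ := x + dot x v • v

def IsRoot (v : Fin 9 → ℤ) : Prop := dot v v = -2 ∧ dot v K = 0

theorem rootReflection_add (v x y : Fin 9 → ℤ) :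
    rootReflection v (x + y) = rootReflection v x + rootReflection v y := by
  simp only [rootReflection, dot_add_left, add_smul]
  abel

theorem IsRoot.dot_rootReflection {v : Fin 9 → ℤ} (hv : IsRoot v) (x y : Fin 9 → ℤ) :
    dot (rootReflection v x) (rootReflection v y) = dot x y := by
  simp only [rootReflection, dot_add_left, dot_add_right, dot_smul_left, dot_smul_right, hv.1,
    dot_comm v y]
  ring

theorem IsRoot.rootReflection_involutive {v : Fin 9 → ℤ} (hv : IsRoot v) :
    Function.Involutive (rootReflection v) := by
  intro x
  simp only [rootReflection, dot_add_left, dot_smul_left, hv.1]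
  module

theorem IsRoot.rootReflection_mem {v : Fin 9 → ℤ} (hv : IsRoot v) {D : Fin 9 → ℤ}
    (hD : D ∈ negClasses) : rootReflection v D ∈ negClasses := by
  rw [mem_negClasses] at hD ⊢
  refine ⟨by rw [hv.dot_rootReflection, hD.1], ?_⟩
  rw [rootReflection, dot_add_left, dot_smul_left, hv.2, hD.2]
  norm_num

theorem IsRoot.card_filter_dot_rootReflection {v : Fin 9 → ℤ} (hv : IsRoot v) (c : ℤ)
    (R : Fin 9 → ℤ) :
    {D ∈ negClasses | dot D (rootReflection v R) = c}.card =
      {D ∈ negClasses | dot D R = c}.card := by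
  refine Finset.card_nbij' (rootReflection v) (rootReflection v) ?_ ?_
    (fun x _ => hv.rootReflection_involutive x) (fun x _ => hv.rootReflection_involutive x)
  · intro D hD
    simp only [Finset.coe_filter, Set.mem_ofPred_eq] at hD ⊢
    refine ⟨hv.rootReflection_mem hD.1, ?_⟩
    rw [← hv.dot_rootReflection, hv.rootReflection_involutive, hD.2]
  · intro D hD
    simp only [Finset.coe_filter, Set.mem_ofPred_eq] at hD ⊢
    exact ⟨hv.rootReflection_mem hD.1, by rw [hv.dot_rootReflection, hD.2]⟩

/-- The simple roots orthogonal to the last exceptional class. -/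
def simpleRootsE7 : List (Fin 9 → ℤ) :=
  [![1, -1, -1, -1, 0, 0, 0, 0, 0], ![0, 1, -1, 0, 0, 0, 0, 0, 0], ![0, 0, 1, -1, 0, 0, 0, 0, 0],
    ![0, 0, 0, 1, -1, 0, 0, 0, 0], ![0, 0, 0, 0, 1, -1, 0, 0, 0], ![0, 0, 0, 0, 0, 1, -1, 0, 0],
    ![0, 0, 0, 0, 0, 0, 1, -1, 0]]

def simpleRootsE8 : List (Fin 9 → ℤ) :=
  ![0, 0, 0, 0, 0, 0, 0, 1, -1] :: simpleRootsE7

/-- A vector whose product with every simple root is `1`. -/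
def weylVector : Fin 9 → ℤ := ![-5, 1, 2, 3, 4, 5, 6, 7, 8]

theorem isRoot_of_mem_simpleRootsE8 {v : Fin 9 → ℤ} (hv : v ∈ simpleRootsE8) : IsRoot v := by
  have h : ∀ v ∈ simpleRootsE8, dot v v = -2 ∧ dot v K = 0 := by decide +kernel
  exact h v hv

/-- To prove a property of (-1)-classes, it suffices to prove it for the dominant ones and to
transport it along simple reflections. -/
theorem negClass_induction {T : List (Fin 9 → ℤ)} (hT : T ⊆ simpleRootsE8)
    {P : (Fin 9 → ℤ) → Prop}
    (base : ∀ D ∈ negClasses, (∀ v ∈ T, 0 ≤ dot D v) → P D)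
    (step : ∀ v ∈ T, ∀ D ∈ negClasses, P (rootReflection v D) → P D) :
    ∀ D ∈ negClasses, P D := by
  classical
  by_contra! hcon
  obtain ⟨D₀, hD₀, hPD₀⟩ := hcon
  obtain ⟨D, hD, hmin⟩ := Finset.exists_min_image {D ∈ negClasses | ¬ P D}
    (fun D => dot D weylVector) ⟨D₀, by simp [hD₀, hPD₀]⟩
  simp only [Finset.mem_filter] at hD hmin
  have hdom : ¬ ∀ v ∈ T, 0 ≤ dot D v := fun h => hD.2 (base D hD.1 h)
  push Not at hdom
  obtain ⟨v, hv, hneg⟩ := hdom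
  have hw : ∀ v ∈ simpleRootsE8, dot v weylVector = 1 := by decide +kernel
  have := hmin (rootReflection v D)
    ⟨(isRoot_of_mem_simpleRootsE8 (hT hv)).rootReflection_mem hD.1,
      fun h => hD.2 (step v hv D hD.1 h)⟩
  rw [rootReflection, dot_add_left, dot_smul_left, hw v (hT hv)] at this
  omega

def lastExceptional : Fin 9 → ℤ := ![0, 0, 0, 0, 0, 0, 0, 0, 1]

theorem eq_lastExceptional_of_dominant : ∀ D ∈ negClasses,
    (∀ v ∈ simpleRootsE8, 0 ≤ dot D v) → D = lastExceptional := by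
  change ∀ D ∈ negClassList, _
  decide +kernel

theorem eq_of_dominant_of_dot_lastExceptional : ∀ D ∈ negClasses,
    (∀ v ∈ simpleRootsE7, 0 ≤ dot D v) → dot lastExceptional D = 1 →
      D = ![1, -1, 0, 0, 0, 0, 0, 0, -1] := by
  change ∀ D ∈ negClassList, _
  decide +kernel

theorem card_filter_dot_eq_one {D : Fin 9 → ℤ} (hD : D ∈ negClasses) :
    {D' ∈ negClasses | dot D' D = 1}.card = 126 := by
  refine negClass_induction (P := fun D => {D' ∈ negClasses | dot D' D = 1}.card = 126)
    (List.Subset.refl simpleRootsE8) ?_ ?_ D hD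
  · intro D hD hdom
    rw [eq_lastExceptional_of_dominant D hD hdom]
    change (negClassList.filter fun D' => dot D' lastExceptional = 1).length = 126
    decide +kernel
  · intro v hv D _ h
    rwa [(isRoot_of_mem_simpleRootsE8 hv).card_filter_dot_rootReflection] at h

theorem card_filter_dot_ruling_eq_zero {D₁ D₂ : Fin 9 → ℤ} (h₁ : D₁ ∈ negClasses)
    (h₂ : D₂ ∈ negClasses) (h : dot D₁ D₂ = 1) :
    {D ∈ negClasses | dot D (D₁ + D₂) = 0}.card = 14 := by
  refine negClass_induction (P := fun D₁ => ∀ D₂ ∈ negClasses, dot D₁ D₂ = 1 →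
    {D ∈ negClasses | dot D (D₁ + D₂) = 0}.card = 14)
    (List.Subset.refl simpleRootsE8) ?_ ?_ D₁ h₁ D₂ h₂ h
  · intro D hD hdom
    rw [eq_lastExceptional_of_dominant D hD hdom]
    refine negClass_induction (T := simpleRootsE7) (List.subset_cons_self _ _) ?_ ?_
    · intro D₂ hD₂ hdom₂ hdot
      rw [eq_of_dominant_of_dot_lastExceptional D₂ hD₂ hdom₂ hdot]
      change (negClassList.filter fun D =>
        dot D (lastExceptional + ![1, -1, 0, 0, 0, 0, 0, 0, -1]) = 0).length = 14
      decide +kernel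
    · intro v hv D₂ _ ih hdot
      have hroot := isRoot_of_mem_simpleRootsE8 (List.mem_cons_of_mem _ hv)
      have horth : ∀ v ∈ simpleRootsE7, dot lastExceptional v = 0 := by decide +kernel
      have hfix : rootReflection v lastExceptional = lastExceptional := by
        rw [rootReflection, horth v hv, zero_smul, add_zero]
      rw [← hroot.card_filter_dot_rootReflection, rootReflection_add, hfix]
      refine ih ?_
      rw [← hfix, hroot.dot_rootReflection, hdot]
  · intro v hv D₁ _ ih D₂ hD₂ hdot
    have hroot := isRoot_of_mem_simpleRootsE8 hv
    rw [← hroot.card_filter_dot_rootReflection, rootReflection_add]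
    exact ih _ (hroot.rootReflection_mem hD₂) (by rw [hroot.dot_rootReflection, hdot])

/-! ### Rulings -/

attribute [irreducible] negClasses

theorem IsRuling.card_filter_dot_eq_zero {R : Fin 9 → ℤ} (hR : IsRuling R) :
    {D ∈ negClasses | dot D R = 0}.card = 14 := by
  obtain ⟨D₁, D₂, h₁, h₂, h, rfl⟩ := hR
  exact card_filter_dot_ruling_eq_zero (mem_negClasses.2 h₁) (mem_negClasses.2 h₂) h

theorem IsRuling.isNegClass_sub {R D : Fin 9 → ℤ} (hR : IsRuling R) (hD : isNegClass D)
    (h : dot D R = 0) : isNegClass (R - D) ∧ dot D (R - D) = 1 := by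
  obtain ⟨D₁, D₂, h₁, h₂, h₁₂, rfl⟩ := hR
  have h₂₁ := dot_comm D₂ D₁
  have hc := dot_comm D (D₁ + D₂)
  simp only [isNegClass, dot_sub_left, dot_sub_right, dot_add_left, dot_add_right] at *
  omega

theorem dot_add_self_of_dot_eq_one {D₁ D₂ : Fin 9 → ℤ} (h₁ : isNegClass D₁)
    (h : dot D₁ D₂ = 1) : dot D₁ (D₁ + D₂) = 0 := by
  rw [dot_add_right, h₁.1, h]
  norm_num

theorem ncard_rulings : {R : Fin 9 → ℤ | IsRuling R}.ncard = 2160 := by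
  set P := {p ∈ negClasses ×ˢ negClasses | dot p.2 p.1 = 1} with hP
  have memP : ∀ p, p ∈ P ↔ isNegClass p.1 ∧ isNegClass p.2 ∧ dot p.1 p.2 = 1 := by
    intro p
    rw [hP, Finset.mem_filter, Finset.mem_product, mem_negClasses, mem_negClasses, and_assoc,
      dot_comm]
  have hset : {R : Fin 9 → ℤ | IsRuling R} = ↑(P.image fun p => p.1 + p.2) := by
    ext R
    simp only [Set.mem_ofPred_eq, Finset.coe_image, Set.mem_image, Finset.mem_coe, memP,
      Prod.exists, IsRuling]
    constructor
    · rintro ⟨D₁, D₂, h₁, h₂, h, rfl⟩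
      exact ⟨D₁, D₂, ⟨h₁, h₂, h⟩, rfl⟩
    · rintro ⟨D₁, D₂, ⟨h₁, h₂, h⟩, rfl⟩
      exact ⟨D₁, D₂, h₁, h₂, h, rfl⟩
  rw [hset, Set.ncard_coe_finset]
  have hcard : P.card = 30240 := by
    rw [hP, Finset.card_filter, Finset.sum_product]
    simp only [← Finset.card_filter]
    rw [Finset.sum_congr rfl fun D hD => card_filter_dot_eq_one hD, Finset.sum_const,
      card_negClasses, smul_eq_mul]
  have hfib : P.card = (P.image fun p => p.1 + p.2).card * 14 := by
    rw [Finset.card_eq_sum_card_image (fun p => p.1 + p.2) P]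
    refine Finset.sum_const_nat fun R hR => ?_
    have hR' : IsRuling R := by
      rw [← Finset.mem_coe, ← hset] at hR
      exact hR
    rw [← hR'.card_filter_dot_eq_zero]
    refine Finset.card_nbij' Prod.fst (fun D => (D, R - D)) ?_ ?_ ?_ ?_
    · rintro ⟨D₁, D₂⟩ h
      simp only [Finset.coe_filter, Set.mem_ofPred_eq, memP, mem_negClasses] at h ⊢
      obtain ⟨⟨h₁, -, h₁₂⟩, rfl⟩ := h
      exact ⟨h₁, dot_add_self_of_dot_eq_one h₁ h₁₂⟩
    · intro D h
      simp only [Finset.coe_filter, Set.mem_ofPred_eq, memP, mem_negClasses] at h ⊢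
      obtain ⟨h₁, h₂⟩ := hR'.isNegClass_sub h.1 h.2
      exact ⟨⟨h.1, h₁, h₂⟩, add_sub_cancel _ _⟩
    · rintro ⟨D₁, D₂⟩ h
      simp only [Finset.coe_filter, Set.mem_ofPred_eq] at h
      simp [← h.2]
    · intro D _
      rfl
  omega

theorem IsRuling.ncard_representations {R : Fin 9 → ℤ} (hR : IsRuling R) :
    {p : Finset (Fin 9 → ℤ) | p.card = 2 ∧ (∀ x ∈ p, isNegClass x) ∧
      (∀ x ∈ p, ∀ y ∈ p, x ≠ y → dot x y = 1) ∧ ∑ x ∈ p, x = R}.ncard = 7 := by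
  set F := {D ∈ negClasses | dot D R = 0} with hF
  have memF : ∀ x, x ∈ F ↔ isNegClass x ∧ dot x R = 0 := by
    intro x
    rw [hF, Finset.mem_filter, mem_negClasses]
  have hne : ∀ x ∈ F, x ≠ R - x := by
    intro x hx h
    obtain ⟨h₁, h₂⟩ := (memF x).1 hx
    have := (hR.isNegClass_sub h₁ h₂).2
    rw [← h, h₁.1] at this
    omega
  have hsub : ∀ x ∈ F, R - x ∈ F := by
    intro x hx
    obtain ⟨h₁, h₂⟩ := (memF x).1 hx
    obtain ⟨h₃, h₄⟩ := hR.isNegClass_sub h₁ h₂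
    refine (memF _).2 ⟨h₃, ?_⟩
    have := dot_add_self_of_dot_eq_one h₃ ((dot_comm _ _).trans h₄)
    rwa [sub_add_cancel] at this
  have hset : {p : Finset (Fin 9 → ℤ) | p.card = 2 ∧ (∀ x ∈ p, isNegClass x) ∧
      (∀ x ∈ p, ∀ y ∈ p, x ≠ y → dot x y = 1) ∧ ∑ x ∈ p, x = R} =
      ↑(F.image fun x => ({x, R - x} : Finset (Fin 9 → ℤ))) := by
    ext p
    simp only [Set.mem_ofPred_eq, Finset.coe_image, Set.mem_image, Finset.mem_coe]
    constructor
    · rintro ⟨hcard, hneg, hdot, hsum⟩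
      obtain ⟨x, y, hxy, rfl⟩ := Finset.card_eq_two.1 hcard
      rw [Finset.sum_pair hxy] at hsum
      subst hsum
      refine ⟨x, (memF x).2 ⟨hneg x (by simp), ?_⟩, by rw [add_sub_cancel_left]⟩
      exact dot_add_self_of_dot_eq_one (hneg x (by simp)) (hdot x (by simp) y (by simp) hxy)
    · rintro ⟨x, hx, rfl⟩
      obtain ⟨h₁, h₂⟩ := (memF x).1 hx
      obtain ⟨h₃, h₄⟩ := hR.isNegClass_sub h₁ h₂
      refine ⟨Finset.card_pair (hne x hx), ?_, ?_, ?_⟩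
      · simp [h₁, h₃]
      · have h₅ := (dot_comm (R - x) x).trans h₄
        intro y hy z hz hyz
        rw [Finset.mem_insert, Finset.mem_singleton] at hy hz
        rcases hy with rfl | rfl <;> rcases hz with rfl | rfl <;> first | assumption | simp at hyz
      · rw [Finset.sum_pair (hne x hx), add_sub_cancel]
  rw [hset, Set.ncard_coe_finset]
  have hfib : F.card = (F.image fun x => ({x, R - x} : Finset (Fin 9 → ℤ))).card * 2 := by
    rw [Finset.card_eq_sum_card_image (fun x => ({x, R - x} : Finset (Fin 9 → ℤ))) F]
    refine Finset.sum_const_nat fun p hp => ?_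
    obtain ⟨x, hx, rfl⟩ := Finset.mem_image.1 hp
    rw [← Finset.card_pair (hne x hx)]
    congr 1
    ext y
    simp only [Finset.mem_filter, Finset.mem_insert, Finset.mem_singleton]
    constructor
    · rintro ⟨-, h⟩
      have : y ∈ ({x, R - x} : Finset (Fin 9 → ℤ)) := h ▸ Finset.mem_insert_self _ _
      simpa using this
    · rintro (rfl | rfl)
      · exact ⟨hx, rfl⟩
      · exact ⟨hsub x hx, by rw [sub_sub_cancel, Finset.pair_comm]⟩
  have hF14 : F.card = 14 := hR.card_filter_dot_eq_zero
  omega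

theorem stmt14 :
    {R : Fin 9 → ℤ | IsRuling R}.ncard = 2160 ∧
    ∀ R : Fin 9 → ℤ, IsRuling R →
      {p : Finset (Fin 9 → ℤ) | p.card = 2 ∧ (∀ x ∈ p, isNegClass x) ∧
        (∀ x ∈ p, ∀ y ∈ p, x ≠ y → dot x y = 1) ∧ ∑ x ∈ p, x = R}.ncard = 7 :=
  ⟨ncard_rulings, fun _ hR => hR.ncard_representations⟩
end
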